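/- arXiv:2310.02322 — 3 statements merged into one kernel-verified Lean document; each statement's English description precedes it below -/
import Mathlib

section
/- There exists a universal constant C > 0 with the following property. Let n ∈ ℕ, ε ∈ (0, 1/2), δ ∈ (0, 1), and set k = ⌈C · ε⁻² · log(2/δ)⌉. If A is a random k × n matrix whose entries A_{ij} are independent and identically distributed Gaussian random variables with mean 0 and variance 1/k, then for every fixed x ∈ ℝⁿ, the probability that (1 − ε)·‖x‖ ≤ ‖A x‖ ≤ (1 + ε)·‖x‖ is at least 1 − δ, where ‖·‖ denotes the Euclidean norm. -/
open MeasureTheory ProbabilityTheory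
open scoped NNReal ENNReal

/-- A linear combination of independent centered Gaussians of variance `v` is a centered Gaussian
whose variance is `v` times the squared norm of the coefficient vector. -/
lemma map_pi_gaussianReal_sum_mul {ι : Type*} [Fintype ι] (v : ℝ≥0) (x : ι → ℝ) :
    (Measure.pi fun _ : ι => gaussianReal 0 v).map (fun a => ∑ j, a j * x j) =
      gaussianReal 0 (v * (∑ j, x j ^ 2).toNNReal) := by
  have hx : 0 ≤ ∑ j, x j ^ 2 := by positivity
  have hmeas : Measurable fun a : ι → ℝ => ∑ j, a j * x j := by fun_prop
  have : IsProbabilityMeasure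
      ((Measure.pi fun _ : ι => gaussianReal 0 v).map (fun a => ∑ j, a j * x j)) :=
    Measure.isProbabilityMeasure_map hmeas.aemeasurable
  apply Measure.ext_of_charFun
  ext t
  rw [charFun_apply_real, integral_map hmeas.aemeasurable (by fun_prop), charFun_gaussianReal]
  have h : ∀ a : ι → ℝ, Complex.exp (t * (∑ j, a j * x j : ℝ) * Complex.I) =
      ∏ j, Complex.exp ((t * x j : ℝ) * (a j) * Complex.I) := by
    intro a
    rw [← Complex.exp_sum]
    congr 1
    push_cast
    rw [Finset.mul_sum, Finset.sum_mul]
    exact Finset.sum_congr rfl fun j _ => by ring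
  simp_rw [h]
  rw [integral_fintype_prod_eq_prod (μ := fun _ => gaussianReal 0 v)
    (fun j (y : ℝ) => Complex.exp ((t * x j : ℝ) * y * Complex.I))]
  simp_rw [← charFun_apply_real, charFun_gaussianReal]
  rw [← Complex.exp_sum]
  congr 1
  push_cast
  rw [Real.coe_toNNReal _ hx]
  push_cast
  simp only [mul_zero, zero_mul, zero_sub, Finset.sum_neg_distrib, Finset.mul_sum,
    Finset.sum_mul, Finset.sum_div]
  congr 1
  exact Finset.sum_congr rfl fun j _ => by ring

/-- A matrix with i.i.d. centered Gaussian entries maps a fixed vector to a vector with i.i.d.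
centered Gaussian coordinates. -/
lemma map_mulVec_of_map_eq_pi_gaussianReal {ι κ Ω : Type*} [Fintype ι] [Fintype κ]
    [MeasurableSpace Ω] {P : Measure Ω} (v : ℝ≥0) {A : Ω → Matrix ι κ ℝ}
    (hA : ∀ i j, Measurable fun ω => A ω i j)
    (hlaw : P.map (fun ω => fun p : ι × κ => A ω p.1 p.2) =
      Measure.pi fun _ : ι × κ => gaussianReal 0 v) (x : κ → ℝ) :
    P.map (fun ω => (A ω).mulVec x) =
      Measure.pi fun _ : ι => gaussianReal 0 (v * (∑ j, x j ^ 2).toNNReal) := by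
  have hcurry : P.map (fun ω => fun i j => A ω i j) =
      Measure.pi fun _ : ι => Measure.pi fun _ : κ => gaussianReal 0 v := by
    have h := Measure.infinitePi_map_curry (ι := ι) (κ := κ) (X := ℝ)
      (fun _ _ => gaussianReal 0 v)
    simp only [Measure.infinitePi_eq_pi] at h
    rw [← h, ← hlaw, Measure.map_map (by fun_prop) (by fun_prop)]
    rfl
  have hcomp : (fun ω => (A ω).mulVec x) =
      (fun M : ι → κ → ℝ => fun i => ∑ j, M i j * x j) ∘ (fun ω => fun i j => A ω i j) := rfl
  rw [hcomp, ← Measure.map_map (by fun_prop) (by fun_prop), hcurry]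
  have hrow := map_pi_gaussianReal_sum_mul v x
  have : ∀ _ : ι, SigmaFinite ((Measure.pi fun _ : κ => gaussianReal 0 v).map
      (fun a => ∑ j, a j * x j)) := fun _ => by rw [hrow]; infer_instance
  have hmeas : Measurable fun a : κ → ℝ => ∑ j, a j * x j := by fun_prop
  rw [Measure.pi_map_pi (μ := fun _ : ι => Measure.pi fun _ : κ => gaussianReal 0 v)
    (f := fun _ a => ∑ j, a j * x j) (fun _ => hmeas.aemeasurable), hrow]

lemma integral_exp_mul_sq_gaussianReal {v : ℝ≥0} (hv : v ≠ 0) {a : ℝ} (ha : 0 < a) :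
    ∫ y, Real.exp ((1 - (a ^ 2)⁻¹) / (2 * v) * y ^ 2) ∂gaussianReal 0 v = a := by
  have hv' : (0 : ℝ) < v := by positivity
  rw [integral_gaussianReal_eq_integral_smul hv]
  have h : ∀ y : ℝ, gaussianPDFReal 0 v y • Real.exp ((1 - (a ^ 2)⁻¹) / (2 * v) * y ^ 2) =
      (√(2 * Real.pi * v))⁻¹ * Real.exp (-(2 * v * a ^ 2)⁻¹ * y ^ 2) := by
    intro y
    rw [gaussianPDFReal_def, smul_eq_mul, mul_assoc, ← Real.exp_add]
    congr 2
    field_simp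
    ring
  simp_rw [h]
  rw [integral_const_mul, integral_gaussian, div_inv_eq_mul,
    show Real.pi * (2 * v * a ^ 2) = (2 * Real.pi * v) * a ^ 2 by ring,
    Real.sqrt_mul (by positivity) (a ^ 2), Real.sqrt_sq ha.le, inv_mul_cancel_left₀ (by positivity)]

lemma mgf_sum_sq_pi_gaussianReal {ι : Type*} [Fintype ι] {v : ℝ≥0} (hv : v ≠ 0) {a : ℝ}
    (ha : 0 < a) :
    mgf (fun y : ι → ℝ => ∑ i, y i ^ 2) (Measure.pi fun _ => gaussianReal 0 v)
      ((1 - (a ^ 2)⁻¹) / (2 * v)) = a ^ Fintype.card ι := by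
  simp_rw [mgf, Finset.mul_sum, Real.exp_sum]
  rw [integral_fintype_prod_eq_pow
    (fun y : ℝ => Real.exp ((1 - (a ^ 2)⁻¹) / (2 * v) * y ^ 2)),
    integral_exp_mul_sq_gaussianReal hv ha]

lemma integrable_exp_mul_sum_sq_pi_gaussianReal {ι : Type*} [Fintype ι] {v : ℝ≥0} (hv : v ≠ 0)
    {a : ℝ} (ha : 0 < a) :
    Integrable (fun y : ι → ℝ => Real.exp ((1 - (a ^ 2)⁻¹) / (2 * v) * ∑ i, y i ^ 2))
      (Measure.pi fun _ => gaussianReal 0 v) := by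
  by_contra h
  have := mgf_sum_sq_pi_gaussianReal (ι := ι) hv ha
  rw [mgf, integral_undef h] at this
  exact (pow_pos ha _).ne this

lemma chernoff_factor_le {v a : ℝ} (hv : 0 < v) (ha : 0 < a) (k : ℕ) :
    Real.exp (-((1 - (a ^ 2)⁻¹) / (2 * v)) * (k * v * a ^ 2)) * a ^ k ≤
      Real.exp (-(k * (a - 1) ^ 2 / 2)) := by
  have h1 : a ^ k ≤ Real.exp (k * (a - 1)) := by
    rw [Real.exp_nat_mul]
    have := Real.add_one_le_exp (a - 1)
    gcongr
    linarith
  calc _ ≤ Real.exp (-((1 - (a ^ 2)⁻¹) / (2 * v)) * (k * v * a ^ 2)) * Real.exp (k * (a - 1)) := by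
        gcongr
    _ = _ := by
        rw [← Real.exp_add]
        congr 1
        field_simp
        ring

/-- Upper tail bound for a scaled chi-squared distribution. -/
lemma measureReal_le_sum_sq_pi_gaussianReal {ι : Type*} [Fintype ι] {v : ℝ≥0} (hv : v ≠ 0)
    {a : ℝ} (ha : 1 ≤ a) :
    (Measure.pi fun _ : ι => gaussianReal 0 v).real
        {y | Fintype.card ι * v * a ^ 2 ≤ ∑ i, y i ^ 2} ≤
      Real.exp (-(Fintype.card ι * (a - 1) ^ 2 / 2)) := by
  have ha0 : 0 < a := by linarith
  have ht : 0 ≤ (1 - (a ^ 2)⁻¹) / (2 * v) := by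
    have := inv_le_one_of_one_le₀ (one_le_pow₀ ha (n := 2))
    exact div_nonneg (by linarith) (by positivity)
  refine (measure_ge_le_exp_mul_mgf _ ht
    (integrable_exp_mul_sum_sq_pi_gaussianReal hv ha0)).trans ?_
  rw [mgf_sum_sq_pi_gaussianReal hv ha0]
  exact chernoff_factor_le (by positivity) ha0 _

/-- Lower tail bound for a scaled chi-squared distribution. -/
lemma measureReal_sum_sq_le_pi_gaussianReal {ι : Type*} [Fintype ι] {v : ℝ≥0} (hv : v ≠ 0)
    {a : ℝ} (ha0 : 0 < a) (ha : a ≤ 1) :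
    (Measure.pi fun _ : ι => gaussianReal 0 v).real
        {y | ∑ i, y i ^ 2 ≤ Fintype.card ι * v * a ^ 2} ≤
      Real.exp (-(Fintype.card ι * (a - 1) ^ 2 / 2)) := by
  have ht : (1 - (a ^ 2)⁻¹) / (2 * v) ≤ 0 := by
    have := (one_le_inv₀ (pow_pos ha0 2)).2 (pow_le_one₀ ha0.le ha (n := 2))
    exact div_nonpos_of_nonpos_of_nonneg (by linarith) (by positivity)
  refine (measure_le_le_exp_mul_mgf _ ht
    (integrable_exp_mul_sum_sq_pi_gaussianReal hv ha0)).trans ?_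
  rw [mgf_sum_sq_pi_gaussianReal hv ha0]
  exact chernoff_factor_le (by positivity) ha0 _

/-- The norm of a vector of i.i.d. centered Gaussians concentrates. -/
lemma measureReal_compl_norm_mem_pi_gaussianReal_le {ι : Type*} [Fintype ι] {v : ℝ≥0}
    (hv : v ≠ 0) {r ε : ℝ} (hr : 0 ≤ r) (hrv : Fintype.card ι * v = r ^ 2)
    (hε : 0 < ε) (hε1 : ε < 1) :
    (Measure.pi fun _ : ι => gaussianReal 0 v).real
        {y | (1 - ε) * r ≤ √(∑ i, y i ^ 2) ∧ √(∑ i, y i ^ 2) ≤ (1 + ε) * r}ᶜ ≤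
      2 * Real.exp (-(Fintype.card ι * ε ^ 2 / 2)) := by
  have hup := measureReal_le_sum_sq_pi_gaussianReal (ι := ι) hv (a := 1 + ε) (by linarith)
  have hlo := measureReal_sum_sq_le_pi_gaussianReal (ι := ι) hv (a := 1 - ε) (by linarith)
    (by linarith)
  rw [hrv, add_sub_cancel_left] at hup
  rw [hrv, show (1 - ε - 1) ^ 2 = ε ^ 2 by ring] at hlo
  refine (measureReal_mono (s₂ := {y | ∑ i, y i ^ 2 ≤ r ^ 2 * (1 - ε) ^ 2} ∪
    {y | r ^ 2 * (1 + ε) ^ 2 ≤ ∑ i, y i ^ 2}) ?_).trans ((measureReal_union_le _ _).trans ?_)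
  · intro y hy
    have hy' : (1 - ε) * r ≤ √(∑ i, y i ^ 2) → (1 + ε) * r < √(∑ i, y i ^ 2) := by
      simpa using hy
    rcases lt_or_ge √(∑ i, y i ^ 2) ((1 - ε) * r) with h | h
    · left
      have := (Real.sqrt_le_left (mul_nonneg (by linarith) hr)).1 h.le
      rwa [mul_pow, mul_comm] at this
    · right
      have := (Real.le_sqrt (mul_nonneg (by linarith) hr) (by positivity)).1 (hy' h).le
      rwa [mul_pow, mul_comm] at this
  · linarith

/-- **Johnson–Lindenstrauss lemma (Gaussian variant).**
There is a universal constant `C > 0` such that for all `n`, `ε ∈ (0, 1/2)`, `δ ∈ (0, 1)`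
and `k = ⌈C · ε⁻² · log (2/δ)⌉`, any random `k × n` matrix `A` whose entries are i.i.d.
Gaussian with mean `0` and variance `1/k` satisfies, for every fixed `x ∈ ℝⁿ`,
`P[(1 − ε)‖x‖ ≤ ‖Ax‖ ≤ (1 + ε)‖x‖] ≥ 1 − δ` (Euclidean norms). -/
theorem johnson_lindenstrauss_gaussian :
    ∃ C : ℝ, 0 < C ∧
      ∀ (n : ℕ) (ε δ : ℝ), ε ∈ Set.Ioo (0 : ℝ) (1 / 2) → δ ∈ Set.Ioo (0 : ℝ) 1 →
        ∀ k : ℕ, k = ⌈C * ε⁻¹ ^ 2 * Real.log (2 / δ)⌉₊ →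
          ∀ (Ω : Type) [MeasurableSpace Ω] (P : Measure Ω), IsProbabilityMeasure P →
            ∀ A : Ω → Matrix (Fin k) (Fin n) ℝ,
              (∀ i j, Measurable fun ω => A ω i j) →
              (Measure.map (fun ω => fun p : Fin k × Fin n => A ω p.1 p.2) P =
                Measure.pi fun _ : Fin k × Fin n => gaussianReal 0 ((k : ℝ≥0))⁻¹) →
              ∀ x : Fin n → ℝ,
                ENNReal.ofReal (1 - δ) ≤
                  P {ω | (1 - ε) * Real.sqrt (∑ i, x i ^ 2) ≤
                            Real.sqrt (∑ i, ((A ω).mulVec x i) ^ 2) ∧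
                          Real.sqrt (∑ i, ((A ω).mulVec x i) ^ 2) ≤
                            (1 + ε) * Real.sqrt (∑ i, x i ^ 2)} := by
  refine ⟨2, two_pos, ?_⟩
  rintro n ε δ ⟨hε, hε2⟩ ⟨hδ, hδ1⟩ k hk Ω _ P hP A hA hlaw x
  have hs : 0 ≤ ∑ i, x i ^ 2 := by positivity
  rcases hs.eq_or_lt with hs0 | hspos
  · have hx : x = 0 := by
      ext i
      have := (Finset.sum_eq_zero_iff_of_nonneg fun j _ => sq_nonneg (x j)).1 hs0.symm i
        (Finset.mem_univ i)
      simpa using this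
    subst hx
    simpa using hδ.le
  have hlog : 0 < Real.log (2 / δ) := Real.log_pos (by rw [lt_div_iff₀ hδ]; linarith)
  have hkpos : 0 < k := by
    rw [hk, Nat.ceil_pos]
    positivity
  have hkle : Real.log (2 / δ) ≤ k * ε ^ 2 / 2 := by
    have : 2 * ε⁻¹ ^ 2 * Real.log (2 / δ) ≤ k := hk ▸ Nat.le_ceil _
    calc Real.log (2 / δ) = 2 * ε⁻¹ ^ 2 * Real.log (2 / δ) * ε ^ 2 / 2 := by field_simp
      _ ≤ _ := by gcongr
  have hv : (k : ℝ≥0)⁻¹ * (∑ j, x j ^ 2).toNNReal ≠ 0 := by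
    have := Real.toNNReal_pos.2 hspos
    positivity
  have hbound := measureReal_compl_norm_mem_pi_gaussianReal_le (ι := Fin k) hv
    (r := √(∑ j, x j ^ 2)) (Real.sqrt_nonneg _) (by
      rw [Real.sq_sqrt hs, Fintype.card_fin, NNReal.coe_mul, Real.coe_toNNReal _ hs]
      push_cast
      field_simp) hε (by linarith)
  have hexp : 2 * Real.exp (-(k * ε ^ 2 / 2)) ≤ δ := by
    calc 2 * Real.exp (-(k * ε ^ 2 / 2)) ≤ 2 * Real.exp (-Real.log (2 / δ)) := by gcongr
      _ = δ := by
        rw [Real.exp_neg, Real.exp_log (by positivity)]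
        field_simp
  have hmeas : MeasurableSet {y : Fin k → ℝ | (1 - ε) * √(∑ j, x j ^ 2) ≤ √(∑ i, y i ^ 2) ∧
      √(∑ i, y i ^ 2) ≤ (1 + ε) * √(∑ j, x j ^ 2)} :=
    measurableSet_setOfPred.2 ((measurableSet_setOfPred.1 (measurableSet_le (by fun_prop)
      (by fun_prop))).and (measurableSet_setOfPred.1 (measurableSet_le (by fun_prop) (by fun_prop))))
  have hAx : Measurable fun ω => (A ω).mulVec x := by
    unfold Matrix.mulVec dotProduct
    fun_prop
  rw [Fintype.card_fin, probReal_compl_eq_one_sub hmeas] at hbound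
  rw [← map_mulVec_of_map_eq_pi_gaussianReal _ hA hlaw x, map_measureReal_apply hAx hmeas]
    at hbound
  rw [ENNReal.ofReal_le_iff_le_toReal (measure_ne_top _ _)]
  rw [Set.preimage_ofPred_eq, measureReal_def] at hbound
  linarith
end

section
/- Let c > 0 and let π⁻, π ∈ ℝ^d be portfolio weight vectors, i.e. ∑_{i=1}^d π⁻_i = 1 and ∑_{i=1}^d π_i = 1. If c · ∑_{i=1}^d |π⁻_i| < 1 (equivalently ∑_{i=1}^d |π⁻_i| < 1/c), then there exists a unique α ∈ [0, 1] satisfying the rebalancing equation 1 − α = c · ∑_{i=1}^d |α·π_i − π⁻_i|. -/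
/-- Convexity of `α ↦ ∑ |α * y i - x i|` along `0 ≤ a ≤ b`, cleared of denominators. -/
theorem mul_sum_abs_mul_sub_le {ι : Type*} (s : Finset ι) (x y : ι → ℝ) {a b : ℝ}
    (ha : 0 ≤ a) (hab : a ≤ b) :
    b * ∑ i ∈ s, |a * y i - x i| ≤
      (b - a) * ∑ i ∈ s, |x i| + a * ∑ i ∈ s, |b * y i - x i| := by
  rw [Finset.mul_sum, Finset.mul_sum, Finset.mul_sum, ← Finset.sum_add_distrib]
  refine Finset.sum_le_sum fun i _ => ?_
  calc b * |a * y i - x i| = |(b - a) * -x i + a * (b * y i - x i)| := by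
        rw [← abs_of_nonneg (ha.trans hab), ← abs_mul, abs_of_nonneg (ha.trans hab)]
        ring_nf
    _ ≤ |(b - a) * -x i| + |a * (b * y i - x i)| := abs_add_le _ _
    _ = (b - a) * |x i| + a * |b * y i - x i| := by
        rw [abs_mul, abs_mul, abs_neg, abs_of_nonneg (sub_nonneg.2 hab), abs_of_nonneg ha]

/-- Two nonnegative solutions of the rebalancing equation cannot be strictly ordered. -/
theorem le_of_rebalancing_eq {ι : Type*} (s : Finset ι) {c : ℝ} (hc : 0 ≤ c) (x y : ι → ℝ)
    (hsmall : c * ∑ i ∈ s, |x i| < 1) {a b : ℝ} (ha : 0 ≤ a)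
    (hea : 1 - a = c * ∑ i ∈ s, |a * y i - x i|)
    (heb : 1 - b = c * ∑ i ∈ s, |b * y i - x i|) : b ≤ a := by
  by_contra! hab
  have hconv := mul_le_mul_of_nonneg_left (mul_sum_abs_mul_sub_le s x y ha hab.le) hc
  have hstrict := mul_lt_mul_of_pos_left hsmall (sub_pos.2 hab)
  refine lt_irrefl (0 : ℝ) ?_
  linear_combination hconv + hstrict + b * hea - a * heb

/-- If `c > 0`, the portfolio weight vectors `πm` (pre-rebalancing) and `π` (target) each sum
to one, and `c · ∑ |πm i| < 1`, then there is a unique `α ∈ [0, 1]` solving the rebalancing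
equation `1 − α = c · ∑ |α·π i − πm i|`. -/
theorem rebalancing_unique_solution (d : ℕ) (c : ℝ) (hc : 0 < c)
    (πm π : Fin d → ℝ) (hπm : ∑ i, πm i = 1) (hπ : ∑ i, π i = 1)
    (hsmall : c * ∑ i, |πm i| < 1) :
    ∃! α : ℝ, α ∈ Set.Icc (0 : ℝ) 1 ∧ 1 - α = c * ∑ i, |α * π i - πm i| := by
  have hcont : Continuous fun α : ℝ => c * ∑ i, |α * π i - πm i| + α := by fun_prop
  obtain ⟨α, hα, heq⟩ : (1 : ℝ) ∈ (fun α : ℝ => c * ∑ i, |α * π i - πm i| + α) '' Set.Icc 0 1 := by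
    refine intermediate_value_Icc zero_le_one hcont.continuousOn ⟨?_, ?_⟩
    · simpa using hsmall.le
    · have : 0 ≤ c * ∑ i, |1 * π i - πm i| := by positivity
      simpa using this
  have hα' : 1 - α = c * ∑ i, |α * π i - πm i| := by
    linear_combination -heq
  refine ⟨α, ⟨hα, hα'⟩, fun β ⟨hβ, hβ'⟩ => le_antisymm ?_ ?_⟩
  · exact le_of_rebalancing_eq _ hc.le πm π hsmall hα.1 hα' hβ'
  · exact le_of_rebalancing_eq _ hc.le πm π hsmall hβ.1 hβ' hα'
end

section
/- For d = 2, transaction-cost proportion c = 1/20, pre-rebalancing weights π⁻ = (131/10, −121/10) and target weights π = (13, −12), the rebalancing equation has no solution: there is no α ∈ ℝ such that 1 − α = (1/20)·(|13α − 131/10| + |−12α + 121/10|). -/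
/-- With `c = 1/20`, `π⁻ = (131/10, −121/10)` and `π = (13, −12)`, the rebalancing
equation `1 − α = (1/20)·(|13α − 131/10| + |−12α + 121/10|)` has no real solution. -/
theorem rebalancing_no_solution :
    ¬ ∃ α : ℝ, 1 - α = (1 / 20) * (|13 * α - 131 / 10| + |(-12) * α + 121 / 10|) := by
  rintro ⟨α, h⟩
  have h₁ := neg_le_abs (13 * α - 131 / 10)
  have h₂ := le_abs_self ((-12) * α + 121 / 10)
  have h₃ := abs_nonneg (13 * α - 131 / 10)
  have h₄ := abs_nonneg ((-12) * α + 121 / 10)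
  linarith
end
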